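/- Let (Γ, Δ^l) be a left covariant π-graded bimodule over A. Then there exists a family of k-linear maps P_α: Γ₁ → Γ_α (α ∈ π), given explicitly by P_α(ρ) = Σ_k S_{α⁻¹}(a_k)·ρ_k whenever Δ^l_{α⁻¹,α}(ρ) = Σ_k a_k ⊗ ρ_k, such that: (i) P_α(ρ) is left invariant for every ρ ∈ Γ₁; (ii) P_α(b·ρ) = ε(b)·P_α(ρ) for all b ∈ A₁ and ρ ∈ Γ₁; (iii) for every α ∈ π and ρ ∈ Γ_α, if Δ^l_{α,1}(ρ) = Σ_k a_k ⊗ ρ_k with a_k ∈ A_α and ρ_k ∈ Γ₁, then ρ = Σ_k a_k·P_α(ρ_k). -/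

import Mathlib

open TensorProduct

/-- The componentwise action of `R ⊗[k] S` on `M ⊗[k] N` induced by `k`-bilinear
actions `f` of `R` on `M` and `g` of `S` on `N`: `(r ⊗ s) • (m ⊗ n) = (f r m) ⊗ (g s n)`. -/
noncomputable def tact {k : Type} [Field k] {R S M N : Type}
    [AddCommGroup R] [Module k R] [AddCommGroup S] [Module k S]
    [AddCommGroup M] [Module k M] [AddCommGroup N] [Module k N]
    (f : R →ₗ[k] M →ₗ[k] M) (g : S →ₗ[k] N →ₗ[k] N) :
    R ⊗[k] S →ₗ[k] (M ⊗[k] N) →ₗ[k] M ⊗[k] N :=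
  TensorProduct.lift (LinearMap.mk₂ k (fun r s => TensorProduct.map (f r) (g s))
    (fun r r' s => by simp only [map_add, TensorProduct.map_add_left])
    (fun c r s => by simp only [map_smul, TensorProduct.map_smul_left])
    (fun r s s' => by simp only [map_add, TensorProduct.map_add_right])
    (fun r c s => by simp only [map_smul, TensorProduct.map_smul_right]))

theorem tact_tmul {k : Type} [Field k] {R S M N : Type}
    [AddCommGroup R] [Module k R] [AddCommGroup S] [Module k S]
    [AddCommGroup M] [Module k M] [AddCommGroup N] [Module k N]
    (f : R →ₗ[k] M →ₗ[k] M) (g : S →ₗ[k] N →ₗ[k] N) (r : R) (s : S) (m : M) (n : N) :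
    tact f g (r ⊗ₜ[k] s) (m ⊗ₜ[k] n) = f r m ⊗ₜ[k] g s n := by
  simp [tact]

/-- Absorbing the first tensor factor of the argument into the acting element. -/
theorem tact_tmul_eq_tact_mul {k : Type} [Field k] {R S N : Type}
    [Ring R] [Algebra k R] [Ring S] [Algebra k S] [AddCommGroup N] [Module k N]
    (g : S →ₗ[k] N →ₗ[k] N) (w : R ⊗[k] S) (v : R) (n : N) :
    tact (LinearMap.mul k R) g w (v ⊗ₜ[k] n)
      = tact (LinearMap.mul k R) g (w * (v ⊗ₜ[k] 1)) (1 ⊗ₜ[k] n) := by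
  induction w using TensorProduct.induction_on with
  | zero => simp
  | tmul p q => simp [tact_tmul]
  | add x y hx hy => simp only [map_add, LinearMap.add_apply, add_mul, hx, hy]

set_option maxHeartbeats 1000000 in
/-- For a left covariant `π`-graded bimodule `(Γ, Δˡ)` over a Hopf
`π`-coalgebra there is a family of projections `P_α : Γ₁ → Γ_α`,
`P_α(ρ) = Σ S_{α⁻¹}(a_k)·ρ_k` for `Δˡ_{α⁻¹,α}(ρ) = Σ a_k ⊗ ρ_k`, whose values are
left invariant, which satisfy `P_α(b·ρ) = ε(b)·P_α(ρ)`, and which reconstruct every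
`ρ ∈ Γ_α` as `ρ = Σ a_k·P_α(ρ_k)` from `Δˡ_{α,1}(ρ) = Σ a_k ⊗ ρ_k`. -/
theorem left_covariant_bimodule_projection_onto_invariants
    {k : Type} [Field k] {G : Type} [Group G]
    (A : G → Type) [∀ α, Ring (A α)] [∀ α, Algebra k (A α)]
    (Δ : ∀ α β γ : G, α * β = γ → (A γ →ₐ[k] A α ⊗[k] A β))
    (ε : A 1 →ₐ[k] k)
    (S : ∀ α β : G, α⁻¹ = β → (A α →ₗ[k] A β))
    (hcoassoc : ∀ (α β γ : G) (x : A (α * β * γ)),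
      (TensorProduct.assoc k (A α) (A β) (A γ))
          ((Algebra.TensorProduct.map (Δ α β (α * β) rfl) (AlgHom.id k (A γ)))
            ((Δ (α * β) γ (α * β * γ) rfl) x))
        = (Algebra.TensorProduct.map (AlgHom.id k (A α)) (Δ β γ (β * γ) rfl))
            ((Δ α (β * γ) (α * β * γ) (mul_assoc α β γ).symm) x))
    (hcounit₁ : ∀ (α : G) (x : A α),
      (TensorProduct.rid k (A α)) ((LinearMap.lTensor (A α) ε.toLinearMap)
        ((Δ α 1 α (mul_one α)) x)) = x)
    (hcounit₂ : ∀ (α : G) (x : A α),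
      (TensorProduct.lid k (A α)) ((LinearMap.rTensor (A α) ε.toLinearMap)
        ((Δ 1 α α (one_mul α)) x)) = x)
    (hantipode₁ : ∀ (α : G) (x : A 1),
      (LinearMap.mul' k (A α)) ((LinearMap.rTensor (A α) (S α⁻¹ α (inv_inv α)))
        ((Δ α⁻¹ α 1 (inv_mul_cancel α)) x)) = ε x • 1)
    (hantipode₂ : ∀ (α : G) (x : A 1),
      (LinearMap.mul' k (A α)) ((LinearMap.lTensor (A α) (S α⁻¹ α (inv_inv α)))
        ((Δ α α⁻¹ 1 (mul_inv_cancel α)) x)) = ε x • 1)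
    (Γ : G → Type) [∀ α, AddCommGroup (Γ α)] [∀ α, Module k (Γ α)]
    (sl sr : ∀ α, A α →ₗ[k] Γ α →ₗ[k] Γ α)
    (hsl_one : ∀ (α : G) (x : Γ α), sl α 1 x = x)
    (hsl_mul : ∀ (α : G) (a b : A α) (x : Γ α), sl α (a * b) x = sl α a (sl α b x))
    (hsr_one : ∀ (α : G) (x : Γ α), sr α 1 x = x)
    (hsr_mul : ∀ (α : G) (a b : A α) (x : Γ α), sr α (a * b) x = sr α b (sr α a x))
    (hslr : ∀ (α : G) (a b : A α) (x : Γ α), sl α a (sr α b x) = sr α b (sl α a x))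
    (Dl : ∀ α β γ : G, α * β = γ → (Γ γ →ₗ[k] A α ⊗[k] Γ β))
    (hDl_sl : ∀ (α β γ : G) (h : α * β = γ) (a : A γ) (ρ : Γ γ),
      Dl α β γ h (sl γ a ρ)
        = tact (LinearMap.mul k (A α)) (sl β) ((Δ α β γ h) a) (Dl α β γ h ρ))
    (hDl_sr : ∀ (α β γ : G) (h : α * β = γ) (a : A γ) (ρ : Γ γ),
      Dl α β γ h (sr γ a ρ)
        = tact ((LinearMap.mul k (A α)).flip) (sr β) ((Δ α β γ h) a) (Dl α β γ h ρ))
    (hDl_coassoc : ∀ (α β γ : G) (ρ : Γ (α * β * γ)),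
      (TensorProduct.assoc k (A α) (A β) (Γ γ))
          ((LinearMap.rTensor (Γ γ) (Δ α β (α * β) rfl).toLinearMap)
            (Dl (α * β) γ (α * β * γ) rfl ρ))
        = (LinearMap.lTensor (A α) (Dl β γ (β * γ) rfl))
            (Dl α (β * γ) (α * β * γ) (mul_assoc α β γ).symm ρ))
    (hDl_counit : ∀ (α : G) (ρ : Γ α),
      (TensorProduct.lid k (Γ α))
        ((LinearMap.rTensor (Γ α) ε.toLinearMap) (Dl 1 α α (one_mul α) ρ)) = ρ) :
    ∃ P : ∀ α : G, Γ 1 →ₗ[k] Γ α,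
      (∀ α : G, P α
          = (TensorProduct.lift ((sl α) ∘ₗ (S α⁻¹ α (inv_inv α)))) ∘ₗ
              (Dl α⁻¹ α 1 (inv_mul_cancel α)))
      ∧ (∀ (α : G) (ρ : Γ 1),
          Dl 1 α α (one_mul α) (P α ρ) = (1 : A 1) ⊗ₜ[k] (P α ρ))
      ∧ (∀ (α : G) (b : A 1) (ρ : Γ 1), P α (sl 1 b ρ) = ε b • P α ρ)
      ∧ (∀ (α : G) (ρ : Γ α) (n : ℕ) (a : Fin n → A α) (ρk : Fin n → Γ 1),
          Dl α 1 α (mul_one α) ρ = ∑ i, (a i) ⊗ₜ[k] (ρk i) →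
          ρ = ∑ i, sl α (a i) (P α (ρk i))) := by
  have hco : ∀ {α β γ αβ βγ δ : G} (h₁ : α * β = αβ) (h₂ : β * γ = βγ)
      (h₃ : αβ * γ = δ) (h₄ : α * βγ = δ) (x : A δ),
      (TensorProduct.assoc k (A α) (A β) (A γ))
          (LinearMap.rTensor (A γ) (Δ α β αβ h₁).toLinearMap (Δ αβ γ δ h₃ x))
        = LinearMap.lTensor (A α) (Δ β γ βγ h₂).toLinearMap (Δ α βγ δ h₄ x) := by
    intro α β γ αβ βγ δ h₁ h₂ h₃ h₄ x
    subst h₁ h₂ h₃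
    exact hcoassoc α β γ x
  have hcoΓ : ∀ {α β γ αβ βγ δ : G} (h₁ : α * β = αβ) (h₂ : β * γ = βγ)
      (h₃ : αβ * γ = δ) (h₄ : α * βγ = δ) (ρ : Γ δ),
      (TensorProduct.assoc k (A α) (A β) (Γ γ))
          (LinearMap.rTensor (Γ γ) (Δ α β αβ h₁).toLinearMap (Dl αβ γ δ h₃ ρ))
        = LinearMap.lTensor (A α) (Dl β γ βγ h₂) (Dl α βγ δ h₄ ρ) := by
    intro α β γ αβ βγ δ h₁ h₂ h₃ h₄ ρ
    subst h₁ h₂ h₃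
    exact hDl_coassoc α β γ ρ
  -- `S(b₁ x) b₂ = ε(b) S(x)`
  have hS_mul : ∀ (α : G) (b : A 1) (x : A α⁻¹),
      LinearMap.mul' k (A α) (LinearMap.rTensor (A α) (S α⁻¹ α (inv_inv α))
        (Δ α⁻¹ α 1 (inv_mul_cancel α) b * (x ⊗ₜ[k] 1)))
        = ε b • S α⁻¹ α (inv_inv α) x := by
    intro α b x
    set s := S α⁻¹ α (inv_inv α) with hs
    set W : A α⁻¹ ⊗[k] A α →ₗ[k] A α := LinearMap.mul' k (A α) ∘ₗ LinearMap.rTensor (A α) s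
      with hW
    have hWΔ : ∀ u, W (Δ α⁻¹ α 1 (inv_mul_cancel α) u) = ε u • 1 := hantipode₁ α
    have hWmul : ∀ t u v, W (t * (u ⊗ₜ[k] v)) = W (t * (u ⊗ₜ[k] 1)) * v := by
      intro t u v
      induction t using TensorProduct.induction_on with
      | zero => simp
      | tmul p q => simp [hW, mul_assoc]
      | add x y hx hy => simp only [add_mul, map_add, hx, hy]
    set t := Δ α⁻¹ α 1 (inv_mul_cancel α) b with ht
    let T : A α⁻¹ ⊗[k] (A α ⊗[k] A α⁻¹) →ₗ[k] A α :=
      LinearMap.mul' k (A α) ∘ₗ TensorProduct.map (W ∘ₗ LinearMap.mulLeft k t) s ∘ₗ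
        (TensorProduct.assoc k (A α⁻¹) (A α) (A α⁻¹)).symm.toLinearMap
    have key := congrArg T (hco (inv_mul_cancel α) (mul_inv_cancel α)
      (one_mul α⁻¹) (mul_one α⁻¹) x)
    have hl : ∀ z : A 1 ⊗[k] A α⁻¹, T (TensorProduct.assoc k (A α⁻¹) (A α) (A α⁻¹)
        (LinearMap.rTensor (A α⁻¹) (Δ α⁻¹ α 1 (inv_mul_cancel α)).toLinearMap z))
        = ε b • s (TensorProduct.lid k (A α⁻¹)
            (LinearMap.rTensor (A α⁻¹) ε.toLinearMap z)) := by
      intro z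
      induction z using TensorProduct.induction_on with
      | zero => simp
      | tmul u v =>
        simp only [T, ht, LinearMap.comp_apply, LinearMap.rTensor_tmul,
          LinearEquiv.coe_coe, LinearEquiv.symm_apply_apply, TensorProduct.map_tmul,
          AlgHom.toLinearMap_apply, LinearMap.mulLeft_apply, ← map_mul (Δ _ _ _ _), hWΔ,
          LinearMap.mul'_apply, TensorProduct.lid_tmul, map_smul]
        simp [mul_smul]
      | add x y hx hy => simp only [map_add, hx, hy, smul_add]
    have hr : ∀ z : A α⁻¹ ⊗[k] A 1, T (LinearMap.lTensor (A α⁻¹)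
        (Δ α α⁻¹ 1 (mul_inv_cancel α)).toLinearMap z)
        = W (t * ((TensorProduct.rid k (A α⁻¹)
            (LinearMap.lTensor (A α⁻¹) ε.toLinearMap z)) ⊗ₜ[k] 1)) := by
      intro z
      induction z using TensorProduct.induction_on with
      | zero => simp
      | tmul u v =>
        have h : ∀ w : A α ⊗[k] A α⁻¹, T (u ⊗ₜ[k] w)
            = W (t * (u ⊗ₜ[k] 1)) * LinearMap.mul' k (A α) (LinearMap.lTensor (A α) s w) := by
          intro w
          induction w using TensorProduct.induction_on with
          | zero => simp
          | tmul p q => simp [T, hWmul t u p, mul_assoc]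
          | add x y hx hy => simp only [TensorProduct.tmul_add, map_add, hx, hy, mul_add]
        have h₂ := h (Δ α α⁻¹ 1 (mul_inv_cancel α) v)
        rw [hs, hantipode₂] at h₂
        simpa [← TensorProduct.smul_tmul'] using h₂
      | add x y hx hy => simp only [map_add, hx, hy, TensorProduct.add_tmul, mul_add]
    rw [hl, hr, hcounit₁, hcounit₂] at key
    exact key.symm
  -- `p₁ ⊗ p₂ S(p₃) = p ⊗ 1`
  have hΔ_S : ∀ (α : G) (p : A 1),
      LinearMap.mul' k (A 1 ⊗[k] A α) (TensorProduct.map (Δ 1 α α (one_mul α)).toLinearMap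
        (Algebra.TensorProduct.includeRight.toLinearMap ∘ₗ S α⁻¹ α (inv_inv α))
        (Δ α α⁻¹ 1 (mul_inv_cancel α) p)) = p ⊗ₜ[k] 1 := by
    intro α p
    set s := S α⁻¹ α (inv_inv α) with hs
    let T : A 1 ⊗[k] (A α ⊗[k] A α⁻¹) →ₗ[k] A 1 ⊗[k] A α :=
      LinearMap.lTensor (A 1) (LinearMap.mul' k (A α) ∘ₗ LinearMap.lTensor (A α) s)
    have key := congrArg T (hco (one_mul α) (mul_inv_cancel α)
      (mul_inv_cancel α) (mul_one 1) p)
    have hl : ∀ z : A α ⊗[k] A α⁻¹, T (TensorProduct.assoc k (A 1) (A α) (A α⁻¹)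
        (LinearMap.rTensor (A α⁻¹) (Δ 1 α α (one_mul α)).toLinearMap z))
        = LinearMap.mul' k (A 1 ⊗[k] A α)
          (TensorProduct.map (Δ 1 α α (one_mul α)).toLinearMap
            (Algebra.TensorProduct.includeRight.toLinearMap ∘ₗ s) z) := by
      intro z
      induction z using TensorProduct.induction_on with
      | zero => simp
      | tmul u v =>
        have h : ∀ w : A 1 ⊗[k] A α, T (TensorProduct.assoc k (A 1) (A α) (A α⁻¹)
            (w ⊗ₜ[k] v)) = w * (1 ⊗ₜ[k] s v) := by
          intro w
          induction w using TensorProduct.induction_on with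
          | zero => simp
          | tmul p q => simp [T]
          | add x y hx hy => simp only [TensorProduct.add_tmul, map_add, hx, hy, add_mul]
        simpa using h (Δ 1 α α (one_mul α) u)
      | add x y hx hy => simp only [map_add, hx, hy]
    have hr : ∀ z : A 1 ⊗[k] A 1, T (LinearMap.lTensor (A 1)
        (Δ α α⁻¹ 1 (mul_inv_cancel α)).toLinearMap z)
        = (TensorProduct.rid k (A 1) (LinearMap.lTensor (A 1) ε.toLinearMap z)) ⊗ₜ[k] 1 := by
      intro z
      induction z using TensorProduct.induction_on with
      | zero => simp
      | tmul u v =>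
        have h := hantipode₂ α v
        rw [← hs] at h
        simp [T, h, TensorProduct.smul_tmul']
      | add x y hx hy => simp only [map_add, hx, hy, TensorProduct.add_tmul]
    rw [hl, hr, hcounit₁] at key
    exact key
  -- `Δ(S(y₁)) (y₂ ⊗ 1) = 1 ⊗ S(y)`
  have hΔS : ∀ (α : G) (y : A α⁻¹),
      LinearMap.mul' k (A 1 ⊗[k] A α) (TensorProduct.map
        ((Δ 1 α α (one_mul α)).toLinearMap ∘ₗ S α⁻¹ α (inv_inv α))
        Algebra.TensorProduct.includeLeft.toLinearMap
        (Δ α⁻¹ 1 α⁻¹ (mul_one α⁻¹) y)) = 1 ⊗ₜ[k] S α⁻¹ α (inv_inv α) y := by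
    intro α y
    have hΔ_S' := hΔ_S α
    set s := S α⁻¹ α (inv_inv α) with hs
    set D := Δ 1 α α (one_mul α) with hD
    let R : A α ⊗[k] A α⁻¹ →ₗ[k] A 1 ⊗[k] A α :=
      LinearMap.mul' k (A 1 ⊗[k] A α) ∘ₗ TensorProduct.map D.toLinearMap
        (Algebra.TensorProduct.includeRight.toLinearMap ∘ₗ s)
    let T : A α⁻¹ ⊗[k] (A α ⊗[k] A α⁻¹) →ₗ[k] A 1 ⊗[k] A α :=
      LinearMap.mul' k (A 1 ⊗[k] A α) ∘ₗ TensorProduct.map (D.toLinearMap ∘ₗ s) R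
    have hR : ∀ p, R (Δ α α⁻¹ 1 (mul_inv_cancel α) p) = p ⊗ₜ[k] 1 := hΔ_S'
    have key := congrArg T (hco (inv_mul_cancel α) (mul_inv_cancel α)
      (one_mul α⁻¹) (mul_one α⁻¹) y)
    have hl : ∀ z : A 1 ⊗[k] A α⁻¹, T (TensorProduct.assoc k (A α⁻¹) (A α) (A α⁻¹)
        (LinearMap.rTensor (A α⁻¹) (Δ α⁻¹ α 1 (inv_mul_cancel α)).toLinearMap z))
        = 1 ⊗ₜ[k] s (TensorProduct.lid k (A α⁻¹)
            (LinearMap.rTensor (A α⁻¹) ε.toLinearMap z)) := by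
      intro z
      induction z using TensorProduct.induction_on with
      | zero => simp
      | tmul u v =>
        have h : ∀ w : A α⁻¹ ⊗[k] A α, T (TensorProduct.assoc k (A α⁻¹) (A α) (A α⁻¹)
            (w ⊗ₜ[k] v))
            = D (LinearMap.mul' k (A α) (LinearMap.rTensor (A α) s w)) * (1 ⊗ₜ[k] s v) := by
          intro w
          induction w using TensorProduct.induction_on with
          | zero => simp
          | tmul p q => simp [T, R, mul_assoc]
          | add x y hx hy => simp only [TensorProduct.add_tmul, map_add, hx, hy, add_mul]
        have h₂ := h (Δ α⁻¹ α 1 (inv_mul_cancel α) u)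
        rw [hs, hantipode₁] at h₂
        simpa using h₂
      | add x y hx hy => simp only [map_add, hx, hy, TensorProduct.tmul_add]
    have hr : ∀ z : A α⁻¹ ⊗[k] A 1, T (LinearMap.lTensor (A α⁻¹)
        (Δ α α⁻¹ 1 (mul_inv_cancel α)).toLinearMap z)
        = LinearMap.mul' k (A 1 ⊗[k] A α) (TensorProduct.map (D.toLinearMap ∘ₗ s)
            Algebra.TensorProduct.includeLeft.toLinearMap z) := by
      intro z
      induction z using TensorProduct.induction_on with
      | zero => simp
      | tmul u v => simp [T, hR]
      | add x y hx hy => simp only [map_add, hx, hy]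
    rw [hl, hr, hcounit₂] at key
    exact key.symm
  refine ⟨fun α => (TensorProduct.lift ((sl α) ∘ₗ (S α⁻¹ α (inv_inv α)))) ∘ₗ
    (Dl α⁻¹ α 1 (inv_mul_cancel α)), fun α => rfl, ?_, ?_, ?_⟩
  · intro α ρ
    have hΔS' := hΔS α
    set s := S α⁻¹ α (inv_inv α) with hs
    set D := Δ 1 α α (one_mul α) with hD
    let T : A α⁻¹ ⊗[k] (A 1 ⊗[k] Γ α) →ₗ[k] A 1 ⊗[k] Γ α :=
      TensorProduct.lift (tact (LinearMap.mul k (A 1)) (sl α) ∘ₗ D.toLinearMap ∘ₗ s)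
    have key := congrArg T (hcoΓ (mul_one α⁻¹) (one_mul α)
      (inv_mul_cancel α) (inv_mul_cancel α) ρ)
    have hl : ∀ z : A α⁻¹ ⊗[k] Γ α, T (TensorProduct.assoc k (A α⁻¹) (A 1) (Γ α)
        (LinearMap.rTensor (Γ α) (Δ α⁻¹ 1 α⁻¹ (mul_one α⁻¹)).toLinearMap z))
        = 1 ⊗ₜ[k] TensorProduct.lift (sl α ∘ₗ s) z := by
      intro z
      induction z using TensorProduct.induction_on with
      | zero => simp
      | tmul y ρ₀ =>
        have h : ∀ w : A α⁻¹ ⊗[k] A 1, T (TensorProduct.assoc k (A α⁻¹) (A 1) (Γ α)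
            (w ⊗ₜ[k] ρ₀))
            = tact (LinearMap.mul k (A 1)) (sl α)
              (LinearMap.mul' k (A 1 ⊗[k] A α) (TensorProduct.map (D.toLinearMap ∘ₗ s)
                Algebra.TensorProduct.includeLeft.toLinearMap w)) (1 ⊗ₜ[k] ρ₀) := by
          intro w
          induction w using TensorProduct.induction_on with
          | zero => simp
          | tmul p q => simpa [T] using tact_tmul_eq_tact_mul (sl α) (D (s p)) q ρ₀
          | add x y hx hy =>
            simp only [TensorProduct.add_tmul, map_add, hx, hy, LinearMap.add_apply]
        have h₂ := h (Δ α⁻¹ 1 α⁻¹ (mul_one α⁻¹) y)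
        rw [hΔS'] at h₂
        simpa [tact_tmul] using h₂
      | add x y hx hy => simp only [map_add, hx, hy, TensorProduct.tmul_add]
    have hr : ∀ z : A α⁻¹ ⊗[k] Γ α, T (LinearMap.lTensor (A α⁻¹) (Dl 1 α α (one_mul α)) z)
        = Dl 1 α α (one_mul α) (TensorProduct.lift (sl α ∘ₗ s) z) := by
      intro z
      induction z using TensorProduct.induction_on with
      | zero => simp
      | tmul u v => simp [T, hDl_sl, hD]
      | add x y hx hy => simp only [map_add, hx, hy]
    rw [hl, hr] at key
    exact key.symm
  · intro α b ρ
    have hS_mul' := hS_mul α b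
    set s := S α⁻¹ α (inv_inv α) with hs
    simp only [LinearMap.comp_apply, hDl_sl]
    induction Dl α⁻¹ α 1 (inv_mul_cancel α) ρ using TensorProduct.induction_on with
    | zero => simp
    | tmul u ρ₀ =>
      have h : ∀ t : A α⁻¹ ⊗[k] A α, TensorProduct.lift (sl α ∘ₗ s)
          (tact (LinearMap.mul k (A α⁻¹)) (sl α) t (u ⊗ₜ[k] ρ₀))
          = sl α (LinearMap.mul' k (A α)
              (LinearMap.rTensor (A α) s (t * (u ⊗ₜ[k] 1)))) ρ₀ := by
        intro t
        induction t using TensorProduct.induction_on with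
        | zero => simp
        | tmul p q => simp [tact_tmul, hsl_mul]
        | add x y hx hy => simp only [map_add, LinearMap.add_apply, add_mul, hx, hy]
      rw [h, hS_mul']
      simp [hs]
    | add x y hx hy => simp only [map_add, hx, hy, smul_add]
  · intro α ρ n a ρk hρ
    set s := S α⁻¹ α (inv_inv α) with hs
    let T : A α ⊗[k] (A α⁻¹ ⊗[k] Γ α) →ₗ[k] Γ α :=
      TensorProduct.lift (sl α) ∘ₗ LinearMap.lTensor (A α) (TensorProduct.lift (sl α ∘ₗ s))
    have key := congrArg T (hcoΓ (mul_inv_cancel α) (inv_mul_cancel α)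
      (one_mul α) (mul_one α) ρ)
    have hl : ∀ z : A 1 ⊗[k] Γ α, T (TensorProduct.assoc k (A α) (A α⁻¹) (Γ α)
        (LinearMap.rTensor (Γ α) (Δ α α⁻¹ 1 (mul_inv_cancel α)).toLinearMap z))
        = TensorProduct.lid k (Γ α) (LinearMap.rTensor (Γ α) ε.toLinearMap z) := by
      intro z
      induction z using TensorProduct.induction_on with
      | zero => simp
      | tmul u ρ₀ =>
        have h : ∀ w : A α ⊗[k] A α⁻¹, T (TensorProduct.assoc k (A α) (A α⁻¹) (Γ α)
            (w ⊗ₜ[k] ρ₀))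
            = sl α (LinearMap.mul' k (A α) (LinearMap.lTensor (A α) s w)) ρ₀ := by
          intro w
          induction w using TensorProduct.induction_on with
          | zero => simp
          | tmul p q => simp [T, hsl_mul]
          | add x y hx hy =>
            simp only [TensorProduct.add_tmul, map_add, hx, hy, LinearMap.add_apply]
        have h₂ := h (Δ α α⁻¹ 1 (mul_inv_cancel α) u)
        rw [hs, hantipode₂] at h₂
        simpa [hsl_one] using h₂
      | add x y hx hy => simp only [map_add, hx, hy]
    rw [hl, hDl_counit, hρ] at key
    simpa [T] using key
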